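/- arXiv:1112.1183 — 2 statements merged into one kernel-verified Lean document; each statement's English description precedes it below -/
import Mathlib

section
/- Let β > 1 and let a_1 a_2 ⋯ be the (−β)-expansion of −β/(β+1). Then a_1 a_2 ⋯ >_alt u_1 u_2 ⋯, where u is the sequence beginning with φ^n(1) for all n ≥ 0 with φ(1) = 100, φ(0) = 1. -/
open Filter Set

/-- The (−β)-transformation on [−β/(β+1), 1/(β+1)). -/
noncomputable def negBetaT (β : ℝ) (x : ℝ) : ℝ := -β * x - ⌊β / (β + 1) - β * x⌋

/-- The digits of the (−β)-expansion of x; `negBetaDigit β x n` is ε_{n+1}(x). -/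
noncomputable def negBetaDigit (β : ℝ) (x : ℝ) (n : ℕ) : ℤ :=
  ⌊β / (β + 1) - β * ((negBetaT β)^[n] x)⌋

/-- The (−β)-expansion of the left endpoint −β/(β+1); index n represents a_{n+1}. -/
noncomputable def negBetaExp (β : ℝ) (n : ℕ) : ℤ := negBetaDigit β (-β / (β + 1)) n

/-- `b` is the (−β)-expansion of `x`. -/
def IsNegBetaExpOf (β : ℝ) (x : ℝ) (b : ℕ → ℤ) : Prop :=
  x ∈ Set.Ico (-β / (β + 1)) (1 / (β + 1)) ∧ ∀ n, b n = negBetaDigit β x n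

/-- Alternating lexicographic strict order (0-based indexing: index k corresponds
to position k+1, so `Even k` means odd position). -/
def AltLt (x y : ℕ → ℤ) : Prop :=
  ∃ k, (∀ i, i < k → x i = y i) ∧ (if Even k then x k < y k else y k < x k)

/-- Alternating lexicographic order. -/
def AltLe (x y : ℕ → ℤ) : Prop := AltLt x y ∨ x = y

def phiW : ℕ → List ℕ
  | 1 => [1, 0, 0]
  | _ => [1]

/-- `uWord n` is φ^n(1), where φ(1) = 100, φ(0) = 1. -/
def uWord : ℕ → List ℕ
  | 0 => [1]
  | n + 1 => (uWord n).flatMap phiW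

/-- The sequence u = 100111001001001110011⋯ starting with φ^n(1) for all n. -/
def uSeq (n : ℕ) : ℤ := ((uWord (n + 1)).getD n 0 : ℕ)

/-- Condition (G): every shifted sequence is ≤_alt the sequence itself. -/
def CondG (a : ℕ → ℤ) : Prop := ∀ k, 1 ≤ k → AltLe (fun n => a (n + k)) a

/-- Condition (L): a >_alt u. -/
def CondL (a : ℕ → ℤ) : Prop := AltLt uSeq a

/-- The periodic sequence (w)^∞. -/
def perSeq (w : List ℤ) : ℕ → ℤ := fun n => w.getD (n % w.length) 0

/-- `a` is an infinite concatenation of blocks from `S`. -/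
def IsInfConcat (S : Set (List ℤ)) (a : ℕ → ℤ) : Prop :=
  ∃ w : ℕ → List ℤ, (∀ n, w n ∈ S) ∧
    ∀ N i, i < (((List.range N).map w).flatten).length →
      (((List.range N).map w).flatten).getD i 0 = a i

/-- Condition (A1). -/
def CondA1 (a : ℕ → ℤ) : Prop :=
  ∀ k, 1 ≤ k → AltLt uSeq (perSeq ((List.range k).map a)) →
    IsInfConcat {(List.range k).map a, (List.range (k - 1)).map a ++ [a (k - 1) - 1, 0]} a →
    a = perSeq ((List.range k).map a)

/-- Condition (A2). -/
def CondA2 (a : ℕ → ℤ) : Prop :=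
  ∀ k, 1 ≤ k → AltLt uSeq (perSeq ((List.range (k - 1)).map a ++ [a (k - 1) + 1])) →
    ¬ IsInfConcat {(List.range k).map a ++ [0], (List.range (k - 1)).map a ++ [a (k - 1) + 1]} a

/-- The cylinder set I_{b_1⋯b_n}. -/
def cylinder (β : ℝ) (w : List ℤ) : Set ℝ :=
  {x | x ∈ Set.Ico (-β / (β + 1)) (1 / (β + 1)) ∧
    ∀ i, i < w.length → negBetaDigit β x i = w.getD i 0}

/-- L_{β,n}: the number of words of length n with nonempty cylinder. -/
noncomputable def Lnum (β : ℝ) (n : ℕ) : ℕ :=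
  Set.ncard {w : List ℤ | w.length = n ∧ (cylinder β w).Nonempty}

/-- L'_{β,n}: the number of words of length n whose cylinder is an interval of
positive length. -/
noncomputable def Lnum' (β : ℝ) (n : ℕ) : ℕ :=
  Set.ncard {w : List ℤ | w.length = n ∧
    ∃ c d : ℝ, c < d ∧ Set.Ioo c d ⊆ cylinder β w ∧ cylinder β w ⊆ Set.Icc c d}

/-- P_n(x) = (−x)^n + Σ_{j=1}^n (a_j+1)(−x)^{n−j}. -/
noncomputable def Pn (a : ℕ → ℤ) (n : ℕ) (x : ℝ) : ℝ :=
  (-x) ^ n + ∑ j ∈ Finset.range n, ((a j : ℝ) + 1) * (-x) ^ (n - 1 - j)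

/-- J_n = {x > 1 : P_j(x) ∈ [0,1] for all 1 ≤ j ≤ n}. -/
def Jn (a : ℕ → ℤ) (n : ℕ) : Set ℝ :=
  {x | 1 < x ∧ ∀ j, 1 ≤ j → j ≤ n → Pn a j x ∈ Set.Icc (0 : ℝ) 1}

/-- The infinite sequence `b` starts with the word `w`. -/
def StartsWith : List ℕ → (ℕ → ℕ) → Prop
  | [], _ => True
  | x :: w, b => b 0 = x ∧ StartsWith w (fun n => b (n + 1))

theorem startsWith_append (v w : List ℕ) (b : ℕ → ℕ) :
    StartsWith (v ++ w) b ↔ StartsWith v b ∧ StartsWith w (fun n => b (n + v.length)) := by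
  induction v generalizing b with
  | nil => simp [StartsWith]
  | cons x v ih =>
    simp only [List.cons_append, StartsWith, ih, List.length_cons, and_assoc]
    simp only [add_assoc]

theorem startsWith_map_range (b : ℕ → ℕ) (k : ℕ) : StartsWith ((List.range k).map b) b := by
  induction k with
  | zero => simp [StartsWith]
  | succ k ih =>
    rw [List.range_succ, List.map_append, startsWith_append]
    refine ⟨ih, ?_⟩
    simp [StartsWith]

theorem StartsWith.congr {w : List ℕ} {b c : ℕ → ℕ} (h : StartsWith w b)
    (hbc : ∀ i, i < w.length → b i = c i) : StartsWith w c := by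
  induction w generalizing b c with
  | nil => trivial
  | cons x w ih =>
    refine ⟨(hbc 0 (by simp)).symm.trans h.1, ih h.2 fun i hi => hbc (i + 1) (by simpa using hi)⟩

theorem StartsWith.eq_of_lt {w : List ℕ} {b c : ℕ → ℕ} (hb : StartsWith w b)
    (hc : StartsWith w c) (i : ℕ) (hi : i < w.length) : b i = c i := by
  induction w generalizing b c i with
  | nil => simp at hi
  | cons x w ih =>
    cases i with
    | zero => exact hb.1.trans hc.1.symm
    | succ i => exact ih hb.2 hc.2 i (by simpa using hi)

theorem startsWith_iff_getD (w : List ℕ) (b : ℕ → ℕ) :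
    StartsWith w b ↔ ∀ i, i < w.length → b i = w.getD i 0 := by
  induction w generalizing b with
  | nil => simp [StartsWith]
  | cons x w ih =>
    simp only [StartsWith, ih, List.length_cons]
    constructor
    · rintro ⟨h0, h⟩ i hi
      cases i with
      | zero => simpa using h0
      | succ i => simpa using h i (by omega)
    · intro h
      exact ⟨by simpa using h 0 (by omega), fun i hi => by simpa using h (i + 1) (by omega)⟩

theorem AltLt.trans {x y z : ℕ → ℤ} (h₁ : AltLt x y) (h₂ : AltLt y z) : AltLt x z := by
  obtain ⟨i, hi, hi'⟩ := h₁
  obtain ⟨j, hj, hj'⟩ := h₂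
  rcases lt_trichotomy i j with h | h | h
  · refine ⟨i, fun m hm => (hi m hm).trans (hj m (hm.trans h)), ?_⟩
    rwa [← hj i h]
  · subst h
    refine ⟨i, fun m hm => (hi m hm).trans (hj m hm), ?_⟩
    split_ifs at * <;> omega
  · refine ⟨j, fun m hm => (hi m (hm.trans h)).trans (hj m hm), ?_⟩
    rwa [hi j h]

theorem altLt_or_eq_or_altLt (x y : ℕ → ℤ) : AltLt x y ∨ x = y ∨ AltLt y x := by
  classical
  by_cases h : ∃ k, x k ≠ y k
  · have hlt : ∀ i, i < Nat.find h → x i = y i := fun i hi => by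
      simpa using Nat.find_min h hi
    have hne := Nat.find_spec h
    by_cases hk : Even (Nat.find h) <;> rcases lt_or_gt_of_ne hne with h' | h'
    · exact Or.inl ⟨_, hlt, by rwa [if_pos hk]⟩
    · exact Or.inr (Or.inr ⟨_, fun i hi => (hlt i hi).symm, by rwa [if_pos hk]⟩)
    · exact Or.inr (Or.inr ⟨_, fun i hi => (hlt i hi).symm, by rwa [if_neg hk]⟩)
    · exact Or.inl ⟨_, hlt, by rwa [if_neg hk]⟩
  · push Not at h
    exact Or.inr (Or.inl (funext h))

/-- The extension of the morphism `φ` to words. -/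
def phiWord (w : List ℕ) : List ℕ := w.flatMap phiW

theorem phiWord_append (v w : List ℕ) : phiWord (v ++ w) = phiWord v ++ phiWord w := by
  simp [phiWord]

theorem exists_phiW_eq_cons (x : ℕ) : ∃ l, phiW x = 1 :: l := by
  unfold phiW
  split <;> simp

theorem phiWord_singleton_of_ne {x : ℕ} (hx : x ≠ 1) : phiWord [x] = [1] := by
  unfold phiWord
  simp only [List.flatMap_cons, List.flatMap_nil, List.append_nil]
  unfold phiW
  split
  · contradiction
  · rfl

theorem phiWord_singleton_one : phiWord [1] = [1, 0, 0] := rfl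

theorem odd_length_phiWord_iff (w : List ℕ) : Odd (phiWord w).length ↔ Odd w.length := by
  induction w with
  | nil => simp [phiWord]
  | cons x w ih =>
    have h : phiWord (x :: w) = phiWord [x] ++ phiWord w := phiWord_append [x] w
    rw [h]
    by_cases hx : x = 1
    · subst hx
      rw [phiWord_singleton_one]
      simp only [List.length_append, List.length_cons, List.length_nil]
      grind
    · rw [phiWord_singleton_of_ne hx]
      simp only [List.length_append, List.length_cons, List.length_nil]
      grind

theorem iterate_phiWord_append (n : ℕ) (v w : List ℕ) :
    phiWord^[n] (v ++ w) = phiWord^[n] v ++ phiWord^[n] w := by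
  induction n generalizing v w with
  | zero => rfl
  | succ n ih => simp only [Function.iterate_succ_apply, phiWord_append, ih]

theorem uWord_eq_iterate (n : ℕ) : uWord n = phiWord^[n] [1] := by
  induction n with
  | zero => rfl
  | succ n ih => rw [Function.iterate_succ_apply', ← ih]; rfl

theorem uWord_add_two (n : ℕ) : uWord (n + 2) = uWord (n + 1) ++ (uWord n ++ uWord n) := by
  have h : phiWord^[n + 1] [0] = uWord n := by
    rw [Function.iterate_succ_apply, uWord_eq_iterate]; rfl
  rw [uWord_eq_iterate (n + 2), Function.iterate_succ_apply, phiWord_singleton_one,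
    show ([1, 0, 0] : List ℕ) = [1] ++ ([0] ++ [0]) from rfl, iterate_phiWord_append,
    iterate_phiWord_append, h, ← uWord_eq_iterate]

theorem odd_length_uWord (n : ℕ) : Odd (uWord n).length := by
  induction n with
  | zero => simp [uWord]
  | succ n ih => exact (odd_length_phiWord_iff _).2 ih

theorem length_uWord_add_two (n : ℕ) :
    (uWord (n + 2)).length = (uWord (n + 1)).length + 2 * (uWord n).length := by
  simp [uWord_add_two]; ring

theorem lt_length_uWord (n : ℕ) : n < (uWord n).length := by
  induction n using Nat.twoStepInduction with
  | zero => simp [uWord]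
  | one => simp [uWord, phiW]
  | more n ih₀ ih₁ => rw [length_uWord_add_two]; omega

theorem length_uWord_succ (m : ℕ) :
    (uWord (2 * m + 1)).length = 2 * (uWord (2 * m)).length + 1 ∧
      (uWord (2 * m + 2)).length + 1 = 2 * (uWord (2 * m + 1)).length := by
  induction m with
  | zero => simp [uWord, phiW]
  | succ m ih =>
    have h₁ := length_uWord_add_two (2 * m + 1)
    have h₂ := length_uWord_add_two (2 * m + 2)
    have h₃ : 2 * (m + 1) = 2 * m + 2 := by ring
    simp only [h₃, add_assoc, Nat.reduceAdd] at h₁ h₂ ih ⊢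
    omega

/-- The natural-number valued version of `uSeq`. -/
def uNat (n : ℕ) : ℕ := (uWord (n + 1)).getD n 0

theorem uSeq_eq (n : ℕ) : uSeq n = (uNat n : ℤ) := rfl

theorem uWord_prefix_succ (n : ℕ) : uWord n <+: uWord (n + 1) := by
  cases n with
  | zero => exact ⟨[0, 0], rfl⟩
  | succ n => exact ⟨_, (uWord_add_two n).symm⟩

theorem uWord_prefix_of_le {m n : ℕ} (h : m ≤ n) : uWord m <+: uWord n := by
  induction h with
  | refl => exact List.prefix_refl _
  | step _ ih => exact ih.trans (uWord_prefix_succ _)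

theorem startsWith_uWord (n : ℕ) : StartsWith (uWord n) uNat := by
  rw [startsWith_iff_getD]
  intro i hi
  have hi' := lt_length_uWord (i + 1)
  have key : ∀ {m k : ℕ}, m ≤ k → i < (uWord m).length →
      (uWord m).getD i 0 = (uWord k).getD i 0 := by
    intro m k hmk him
    obtain ⟨t, ht⟩ := uWord_prefix_of_le hmk
    rw [← ht, List.getD_append _ _ _ _ him]
  unfold uNat
  rcases le_total n (i + 1) with h | h
  · exact (key h hi).symm
  · exact key h (by omega)

/-- `b` is the image of `c` under `φ`. -/
def IsPhiImage (b c : ℕ → ℕ) : Prop := ∀ w, StartsWith w c → StartsWith (phiWord w) b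

theorem isPhiImage_uNat : IsPhiImage uNat uNat := by
  intro w hw
  have h := startsWith_uWord w.length
  have hlt := lt_length_uWord w.length
  have hpre : uWord w.length = w ++ (uWord w.length).drop w.length := by
    conv_lhs => rw [← List.take_append_drop w.length (uWord w.length)]
    congr 1
    rw [startsWith_iff_getD] at h hw
    refine List.ext_getElem (by simp; omega) fun i h₁ h₂ => ?_
    have e₁ := h i (by omega)
    have e₂ := hw i h₂
    rw [List.getD_eq_getElem _ _ (by omega)] at e₁ e₂
    simp [← e₁, ← e₂]
  have h₁ : StartsWith (phiWord (uWord w.length)) uNat := startsWith_uWord (w.length + 1)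
  rw [hpre, phiWord_append, startsWith_append] at h₁
  exact h₁.1

/-- No shift of the sequence `b` exceeds `u`. -/
def ShiftsLe (b : ℕ → ℕ) : Prop := ∀ k, ¬ AltLt uSeq (fun n => (b (n + k) : ℤ))

theorem uNat_le_one (n : ℕ) : uNat n ≤ 1 := by
  have hmem : ∀ m, ∀ x ∈ uWord m, x ≤ 1 := by
    intro m x hx
    cases m with
    | zero => simp [uWord] at hx; omega
    | succ m =>
      simp only [uWord, List.mem_flatMap] at hx
      obtain ⟨y, -, hy⟩ := hx
      unfold phiW at hy
      split at hy <;> simp at hy <;> omega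
  unfold uNat
  rw [List.getD_eq_getElem _ _ (by have := lt_length_uWord (n + 1); omega)]
  exact hmem _ _ (List.getElem_mem _)

theorem startsWith_phiWord_pair {b : ℕ → ℕ} {x y : ℕ} (hx : x ≠ 1)
    (h : StartsWith (phiWord [x, y]) b) : b 0 = 1 ∧ b 1 = 1 := by
  rw [show [x, y] = [x] ++ [y] from rfl, phiWord_append, phiWord_singleton_of_ne hx] at h
  obtain ⟨l, hl⟩ := exists_phiW_eq_cons y
  have : phiWord [y] = 1 :: l := by simp [phiWord, hl]
  rw [this] at h
  exact ⟨h.1, h.2.1⟩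

theorem ShiftsLe.of_isPhiImage {b c : ℕ → ℕ} (hb : ShiftsLe b) (hc : ∀ n, c n ≤ 1)
    (h : IsPhiImage b c) : ShiftsLe c := by
  rintro k ⟨j, hj, hj'⟩
  simp only [uSeq_eq, Nat.cast_lt, Nat.cast_inj] at hj hj'
  set v := (List.range j).map uNat with hv
  set w := (List.range k).map c with hw
  have hvu : StartsWith v uNat := startsWith_map_range _ _
  have hwc : StartsWith w c := startsWith_map_range _ _
  have hwl : w.length = k := by simp [hw]
  have hvl : v.length = j := by simp [hv]
  have hvc : StartsWith v (fun n => c (n + k)) := hvu.congr (by rw [hvl]; exact hj)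
  have hu2 : StartsWith (v ++ [uNat j, uNat (j + 1)]) uNat := by
    rw [startsWith_append, hvl]
    exact ⟨hvu, by simp [StartsWith, add_comm]⟩
  have hc2 : StartsWith (w ++ (v ++ [c (j + k), c (j + 1 + k)])) c := by
    rw [startsWith_append, startsWith_append, hvl, hwl]
    exact ⟨hwc, hvc, by simp [StartsWith, add_comm]⟩
  have hu3 := isPhiImage_uNat _ hu2
  have hc3 := h _ hc2
  rw [phiWord_append, startsWith_append] at hu3
  rw [phiWord_append, phiWord_append, startsWith_append, startsWith_append] at hc3
  obtain ⟨hu4, hu5⟩ := hu3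
  obtain ⟨-, hc4, hc5⟩ := hc3
  have hpar : Odd (phiWord v).length ↔ Odd j := by rw [odd_length_phiWord_iff, hvl]
  set P := (phiWord v).length
  set K := (phiWord w).length
  have hone : ∀ {d : ℕ → ℕ} {y : ℕ}, StartsWith (phiWord [1, y]) d → d 0 = 1 ∧ d 1 = 0 := by
    intro d y hd
    exact ⟨hd.1, hd.2.1⟩
  have hagree : ∀ i, i < P → uNat i = b (i + K) := hu4.eq_of_lt hc4
  have hu1 := uNat_le_one j
  have hc1 := hc (j + k)
  refine hb K ⟨P + 1, fun i hi => ?_, ?_⟩ <;> simp only [uSeq_eq, Nat.cast_lt, Nat.cast_inj]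
  · rcases Nat.lt_succ_iff_lt_or_eq.1 hi with hi | hi
    · exact hagree i hi
    · have e₁ : uNat P = 1 := by
        by_cases hx : uNat j = 1
        · rw [hx] at hu5; simpa using (hone hu5).1
        · simpa using (startsWith_phiWord_pair hx hu5).1
      have e₂ : b (P + K) = 1 := by
        by_cases hx : c (j + k) = 1
        · rw [hx] at hc5; simpa using (hone hc5).1
        · simpa using (startsWith_phiWord_pair hx hc5).1
      subst hi
      rw [e₁, e₂]
  · by_cases hev : Even j
    · have hP' : ¬ Even (P + 1) := by
        rw [Nat.even_add_one, not_not, ← Nat.not_odd_iff_even, hpar, Nat.not_odd_iff_even]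
        exact hev
      rw [if_pos hev] at hj'
      rw [if_neg hP']
      have hx : uNat j ≠ 1 := by omega
      have hy : c (j + k) = 1 := by omega
      rw [hy] at hc5
      have e₁ := (startsWith_phiWord_pair hx hu5).2
      have e₂ := (hone hc5).2
      rw [add_comm] at e₁
      simp only [add_comm 1 P] at e₂
      rw [e₁, e₂]; norm_num
    · have hP' : Even (P + 1) := by
        rw [Nat.even_add_one, Nat.not_even_iff_odd, hpar, ← Nat.not_even_iff_odd]
        exact hev
      rw [if_neg hev] at hj'
      rw [if_pos hP']
      have hx : uNat j = 1 := by omega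
      have hy : c (j + k) ≠ 1 := by omega
      rw [hx] at hu5
      have e₁ := (startsWith_phiWord_pair hy hc5).2
      have e₂ := (hone hu5).2
      rw [add_comm] at e₂
      simp only [add_comm 1 P] at e₁
      rw [e₁, e₂]; norm_num

theorem ShiftsLe.block {b : ℕ → ℕ} (hb : ShiftsLe b) (hb1 : ∀ n, b n ≤ 1) (m : ℕ)
    (h₀ : b m = 1) (h₁ : b (m + 1) = 0) : b (m + 2) = 0 ∧ b (m + 3) = 1 := by
  have hu0 : uSeq 0 = 1 := rfl
  have hu1 : uSeq 1 = 0 := rfl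
  have hu2 : uSeq 2 = 0 := rfl
  have hu3 : uSeq 3 = 1 := rfl
  have h2 : b (m + 2) = 0 := by
    by_contra hne
    refine hb m ⟨2, fun i hi => ?_, ?_⟩
    · interval_cases i
      · simp [hu0, h₀]
      · simp [hu1, add_comm 1 m, h₁]
    · rw [if_pos (by decide), hu2]; simp only [add_comm 2 m]; omega
  refine ⟨h2, ?_⟩
  by_contra hne
  have h3 := hb1 (m + 3)
  refine hb m ⟨3, fun i hi => ?_, ?_⟩
  · interval_cases i
    · simp [hu0, h₀]
    · simp [hu1, add_comm 1 m, h₁]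
    · simp [hu2, add_comm 2 m, h2]
  · rw [if_neg (by decide), hu3]; simp only [add_comm 3 m]; omega

/-- The starting positions of the blocks `1`, `100` in the sequence `b`. -/
def blockPos (b : ℕ → ℕ) : ℕ → ℕ
  | 0 => 0
  | k + 1 => if b (blockPos b k + 1) = 0 then blockPos b k + 3 else blockPos b k + 1

/-- The sequence obtained from `b` by replacing the blocks `100` by `1` and `1` by `0`. -/
def desubst (b : ℕ → ℕ) (k : ℕ) : ℕ := if b (blockPos b k + 1) = 0 then 1 else 0

theorem ShiftsLe.isPhiImage_desubst {b : ℕ → ℕ} (hb : ShiftsLe b) (hb1 : ∀ n, b n ≤ 1)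
    (h0 : b 0 = 1) : IsPhiImage b (desubst b) := by
  have hpos : ∀ k, b (blockPos b k) = 1 := by
    intro k
    induction k with
    | zero => exact h0
    | succ k ih =>
      rw [blockPos]
      split_ifs with h
      · exact (hb.block hb1 _ ih h).2
      · have := hb1 (blockPos b k + 1); omega
  suffices H : ∀ w, StartsWith w (desubst b) →
      StartsWith (phiWord w) b ∧ (phiWord w).length = blockPos b w.length from
    fun w hw => (H w hw).1
  intro w
  induction w using List.reverseRecOn with
  | nil => intro _; simp [phiWord, StartsWith, blockPos]
  | append_singleton w x ih =>
    intro hw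
    rw [startsWith_append] at hw
    obtain ⟨hw₁, hw₂⟩ := hw
    obtain ⟨ih₁, ih₂⟩ := ih hw₁
    have hx : desubst b w.length = x := by simpa [StartsWith] using hw₂
    rw [phiWord_append, startsWith_append, ih₂, List.length_append, List.length_append, ih₂,
      List.length_singleton, blockPos]
    have hp := hpos w.length
    by_cases h : b (blockPos b w.length + 1) = 0
    · have hx1 : x = 1 := by rw [← hx, desubst, if_pos h]
      subst hx1
      have h' := (hb.block hb1 _ hp h).1
      rw [phiWord_singleton_one, if_pos h]
      refine ⟨⟨ih₁, ?_⟩, rfl⟩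
      simp only [StartsWith, and_true, zero_add]
      exact ⟨hp, by rwa [add_comm], by rwa [add_comm]⟩
    · have hx1 : x = 0 := by rw [← hx, desubst, if_neg h]
      subst hx1
      rw [phiWord_singleton_of_ne (by norm_num), if_neg h]
      refine ⟨⟨ih₁, ?_⟩, rfl⟩
      simpa [StartsWith] using hp

/-- The composition of the affine maps `s ↦ 1 + x - β s` along the digits `x` of a word. -/
noncomputable def wordMap (β : ℝ) : List ℕ → ℝ → ℝ
  | [], s => s
  | x :: w, s => wordMap β w (1 + x - β * s)

theorem wordMap_append (β : ℝ) (v w : List ℕ) (s : ℝ) :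
    wordMap β (v ++ w) s = wordMap β w (wordMap β v s) := by
  induction v generalizing s with
  | nil => rfl
  | cons x v ih => exact ih _

theorem wordMap_sub (β : ℝ) (w : List ℕ) (s t : ℝ) :
    wordMap β w s - wordMap β w t = (-β) ^ w.length * (s - t) := by
  induction w generalizing s t with
  | nil => simp [wordMap]
  | cons x w ih => rw [wordMap, wordMap, ih, List.length_cons, pow_succ]; ring

/-- The distance from `1` to its image under the map of the word `φ^n(1)`. -/
noncomputable def uGap (β : ℝ) (n : ℕ) : ℝ := 1 - wordMap β (uWord n) 1

theorem wordMap_uWord (β : ℝ) (n : ℕ) (t : ℝ) :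
    wordMap β (uWord n) (1 - t) = 1 - uGap β n + β ^ (uWord n).length * t := by
  have h := wordMap_sub β (uWord n) (1 - t) 1
  rw [(odd_length_uWord n).neg_pow] at h
  unfold uGap
  linarith

theorem uGap_add_two (β : ℝ) (n : ℕ) :
    uGap β (n + 2) = β ^ (2 * (uWord n).length) * uGap β (n + 1) -
      (β ^ (uWord n).length - 1) * uGap β n := by
  have h₁ : wordMap β (uWord (n + 1)) 1 = 1 - uGap β (n + 1) := by unfold uGap; ring
  have h₂ : wordMap β (uWord (n + 2)) 1 =
      1 - uGap β n + β ^ (uWord n).length *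
        (uGap β n - β ^ (uWord n).length * uGap β (n + 1)) := by
    rw [uWord_add_two, wordMap_append, wordMap_append, h₁, wordMap_uWord,
      show ∀ x y : ℝ, 1 - x + y = 1 - (x - y) from fun x y => by ring, wordMap_uWord]
  rw [uGap, h₂, pow_mul']
  ring

theorem uGap_succ (β : ℝ) (m : ℕ) :
    uGap β (2 * m + 1) = uGap β (2 * m) * (β ^ (uWord (2 * m)).length - 1) * β ∧
      uGap β (2 * m + 2) * β = uGap β (2 * m + 1) * (β ^ (uWord (2 * m + 1)).length - 1) := by
  have second : ∀ m, uGap β (2 * m + 1) = uGap β (2 * m) * (β ^ (uWord (2 * m)).length - 1) * β →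
      uGap β (2 * m + 2) * β =
        uGap β (2 * m + 1) * (β ^ (uWord (2 * m + 1)).length - 1) := by
    intro m h
    rw [uGap_add_two, (length_uWord_succ m).1, pow_succ]
    linear_combination h
  induction m with
  | zero =>
    have h : uGap β (2 * 0 + 1) = uGap β (2 * 0) * (β ^ (uWord (2 * 0)).length - 1) * β := by
      simp [uGap, uWord, phiW, wordMap]; ring
    exact ⟨h, second 0 h⟩
  | succ m ih =>
    have h : uGap β (2 * (m + 1) + 1) =
        uGap β (2 * (m + 1)) * (β ^ (uWord (2 * (m + 1))).length - 1) * β := by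
      have e := (length_uWord_succ m).2
      rw [show 2 * (m + 1) + 1 = 2 * m + 1 + 2 by ring, uGap_add_two, ← e,
        show 2 * (m + 1) = 2 * m + 2 by ring, pow_succ]
      linear_combination ih.2
    exact ⟨h, second _ h⟩

theorem uGap_succ_ge {β : ℝ} (hβ : 1 < β) (n : ℕ) :
    0 < uGap β n ∧ uGap β n * (β ^ (uWord n).length - 1) ≤ uGap β (n + 1) * β := by
  have hβ0 : 0 < β := by linarith
  have hfac : ∀ n, 0 < β ^ (uWord n).length - 1 := fun n => by
    have := one_lt_pow₀ hβ (n := (uWord n).length) (by have := lt_length_uWord n; omega)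
    linarith
  have hstep : ∀ n, 0 < uGap β n →
      uGap β n * (β ^ (uWord n).length - 1) ≤ uGap β (n + 1) * β := by
    intro n hn
    have hpos := mul_pos hn (hfac n)
    rcases Nat.even_or_odd' n with ⟨m, rfl | rfl⟩
    · rw [(uGap_succ β m).1, mul_assoc _ β β]
      exact le_mul_of_one_le_right hpos.le (by nlinarith)
    · exact (uGap_succ β m).2.ge
  have hp : 0 < uGap β n := by
    induction n with
    | zero => simp [uGap, uWord, wordMap]; linarith
    | succ n ih =>
      exact pos_of_mul_pos_left ((mul_pos ih (hfac n)).trans_le (hstep n ih)) hβ0.le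
  exact ⟨hp, hstep n hp⟩

theorem exists_one_lt_uGap {β : ℝ} (hβ : 1 < β) : ∃ n, 1 < uGap β n := by
  obtain ⟨N, hN⟩ := pow_unbounded_of_one_lt (2 * β + 1) hβ
  have hdouble : ∀ m, 2 ^ m * uGap β N ≤ uGap β (N + m) := by
    intro m
    induction m with
    | zero => simp
    | succ m ih =>
      obtain ⟨hpos, hge⟩ := uGap_succ_ge hβ (N + m)
      have hle : β ^ N ≤ β ^ (uWord (N + m)).length :=
        pow_le_pow_right₀ hβ.le (by have := lt_length_uWord (N + m); omega)
      have h : 2 * uGap β (N + m) * β ≤ uGap β (N + m + 1) * β := by nlinarith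
      have h' := le_of_mul_le_mul_right h (by linarith)
      rw [← add_assoc, pow_succ]
      linarith
  have hpos := (uGap_succ_ge hβ N).1
  obtain ⟨m, hm⟩ := pow_unbounded_of_one_lt (1 / uGap β N) (one_lt_two)
  refine ⟨N + m, lt_of_lt_of_le ?_ (hdouble m)⟩
  rwa [div_lt_iff₀ hpos] at hm

theorem wordMap_orbit {β : ℝ} {s : ℕ → ℝ} {a : ℕ → ℕ}
    (hs : ∀ n, s (n + 1) = 1 + a n - β * s n) {w : List ℕ} (h : StartsWith w a) :
    wordMap β w (s 0) = s w.length := by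
  induction w generalizing s a with
  | nil => rfl
  | cons x w ih =>
    rw [wordMap, ← h.1, ← hs 0]
    exact ih (s := fun n => s (n + 1)) (fun n => hs (n + 1)) h.2

theorem not_altLt_shift_of_orbit {β : ℝ} (hβ : 0 < β) {s : ℕ → ℝ} {a : ℕ → ℤ} (h0 : s 0 = 1)
    (hle : ∀ n, s n ≤ 1) (ha : ∀ n, a n = ⌊β * s n⌋)
    (hs : ∀ n, s (n + 1) = 1 + a n - β * s n) (k : ℕ) :
    ¬ AltLt a (fun n => a (n + k)) := by
  rintro ⟨j, hj, hj'⟩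
  have hdiff : ∀ i, i ≤ j → s (i + k) - s i = (-β) ^ i * (s k - 1) := by
    intro i
    induction i with
    | zero => intro _; simp [h0]
    | succ i ih =>
      intro hi
      have e : (a i : ℝ) = a (i + k) := by exact_mod_cast hj i hi
      rw [show i + 1 + k = i + k + 1 by ring, hs, hs, pow_succ]
      linear_combination (-β) * ih (by omega) - e
  have h := hdiff j le_rfl
  have hk := hle k
  have hpow : 0 < β ^ j := pow_pos hβ j
  beta_reduce at hj'
  split_ifs at hj' with hev
  · rw [hev.neg_pow] at h
    have : s (j + k) ≤ s j := by nlinarith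
    have : a (j + k) ≤ a j := by
      rw [ha, ha]; exact Int.floor_le_floor (by gcongr)
    omega
  · rw [(Nat.not_even_iff_odd.1 hev).neg_pow] at h
    have : s j ≤ s (j + k) := by nlinarith
    have : a j ≤ a (j + k) := by
      rw [ha, ha]; exact Int.floor_le_floor (by gcongr)
    omega

theorem not_shiftsLe_of_orbit {β : ℝ} (hβ : 1 < β) {s : ℕ → ℝ} {a : ℕ → ℕ} (h0 : s 0 = 1)
    (hpos : ∀ n, 0 < s n) (hle : ∀ n, s n ≤ 1) (ha0 : a 0 = 1) (ha1 : ∀ n, a n ≤ 1)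
    (hs : ∀ n, s (n + 1) = 1 + a n - β * s n) : ¬ ShiftsLe a := by
  intro hS
  have hlevel : ∀ n, ∃ b : ℕ → ℕ, ShiftsLe b ∧ (∀ i, b i ≤ 1) ∧ b 0 = 1 ∧
      ∀ w, StartsWith w b → StartsWith (phiWord^[n] w) a := by
    intro n
    induction n with
    | zero => exact ⟨a, hS, ha1, ha0, fun w hw => hw⟩
    | succ n ih =>
      obtain ⟨b, hb, hb1, hb0, hba⟩ := ih
      have himg := hb.isPhiImage_desubst hb1 hb0
      have hc1 : ∀ i, desubst b i ≤ 1 := fun i => by unfold desubst; split_ifs <;> omega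
      refine ⟨desubst b, hb.of_isPhiImage hc1 himg, hc1, ?_, fun w hw => ?_⟩
      · by_contra hc0
        have hpair : StartsWith [desubst b 0, desubst b 1] (desubst b) := by simp [StartsWith]
        obtain ⟨-, hb'⟩ := startsWith_phiWord_pair hc0 (himg _ hpair)
        have h11 : StartsWith ([1] ++ [1]) b := by simp [StartsWith, hb0, hb']
        have hww := hba _ h11
        rw [iterate_phiWord_append, ← uWord_eq_iterate] at hww
        have horb := wordMap_orbit hs hww
        have hgap : wordMap β (uWord n) 1 = 1 - uGap β n := by unfold uGap; ring
        rw [h0, wordMap_append, hgap, wordMap_uWord] at horb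
        have hle' := hle (uWord n ++ uWord n).length
        have hpow := one_lt_pow₀ hβ (n := (uWord n).length)
          (by have := lt_length_uWord n; omega)
        nlinarith [(uGap_succ_ge hβ n).1]
      · rw [Function.iterate_succ_apply]
        exact hba _ (himg w hw)
  obtain ⟨n, hn⟩ := exists_one_lt_uGap hβ
  obtain ⟨b, -, -, hb0, hba⟩ := hlevel n
  have hw := hba [1] (by simp [StartsWith, hb0])
  rw [← uWord_eq_iterate] at hw
  have horb := wordMap_orbit hs hw
  have := hpos (uWord n).length
  rw [h0] at horb
  unfold uGap at hn
  linarith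

theorem negBetaExp_orbit {β : ℝ} (hβ : 1 < β) : ∃ s : ℕ → ℝ, s 0 = 1 ∧
    (∀ n, 0 < s n ∧ s n ≤ 1) ∧ (∀ n, negBetaExp β n = ⌊β * s n⌋) ∧
    ∀ n, s (n + 1) = 1 + negBetaExp β n - β * s n := by
  have hne : β + 1 ≠ 0 := by linarith
  set x : ℕ → ℝ := fun n => (negBetaT β)^[n] (-β / (β + 1)) with hx
  set s : ℕ → ℝ := fun n => 1 / (β + 1) - x n with hs
  have hfl : ∀ n, β / (β + 1) - β * x n = β * s n := fun n => by simp only [hs]; ring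
  have ha : ∀ n, negBetaExp β n = ⌊β * s n⌋ := fun n => by rw [← hfl]; rfl
  have h0 : s 0 = 1 := by
    simp only [hs, hx, Function.iterate_zero, id]
    field_simp
    ring
  have hstep : ∀ n, s (n + 1) = 1 + negBetaExp β n - β * s n := by
    intro n
    have hx' : x (n + 1) = -β * x n - negBetaExp β n := by
      simp only [hx, Function.iterate_succ_apply']; rfl
    simp only [hs]
    rw [hx']
    field_simp
    ring
  refine ⟨s, h0, fun n => ?_, ha, hstep⟩
  cases n with
  | zero => rw [h0]; norm_num
  | succ n =>
    rw [hstep, ha]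
    have h₁ := Int.floor_le (β * s n)
    have h₂ := Int.lt_floor_add_one (β * s n)
    constructor <;> linarith

/-- the (−β)-expansion of −β/(β+1) is >_alt u. -/
theorem stmt_9 (β : ℝ) (hβ : 1 < β) (a : ℕ → ℤ) (ha : ∀ n, a n = negBetaExp β n) :
    AltLt uSeq a := by
  obtain ⟨s, h0, hs, hfl, hstep⟩ := negBetaExp_orbit hβ
  have hu0 : uSeq 0 = 1 := rfl
  simp only [← ha] at hfl hstep
  rcases le_or_gt 2 β with h2 | h2
  · refine ⟨0, by simp, ?_⟩
    rw [if_pos (by decide), hu0, hfl, h0, mul_one]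
    have : (2 : ℤ) ≤ ⌊β⌋ := Int.le_floor.2 (by exact_mod_cast h2)
    omega
  have hnonneg : ∀ n, 0 ≤ a n := fun n => by
    rw [hfl]; exact Int.floor_nonneg.2 (mul_nonneg (by linarith) (hs n).1.le)
  have hle1 : ∀ n, a n ≤ 1 := fun n => by
    have : ⌊β * s n⌋ < 2 := Int.floor_lt.2 (by push_cast; nlinarith [(hs n).1, (hs n).2])
    rw [hfl]; omega
  have ha0 : a 0 = 1 := by
    have : (1 : ℤ) ≤ ⌊β⌋ := Int.le_floor.2 (by exact_mod_cast hβ.le)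
    have h := hfl 0
    rw [h0, mul_one] at h
    have := hle1 0
    omega
  have hcast : ∀ n, ((a n).toNat : ℤ) = a n := fun n => Int.toNat_of_nonneg (hnonneg n)
  by_contra hnot
  refine not_shiftsLe_of_orbit hβ (s := s) (a := fun n => (a n).toNat) h0 (fun n => (hs n).1)
    (fun n => (hs n).2) (by simp [ha0]) (fun n => by have := hle1 n; omega) (fun n => ?_) ?_
  · have : (((a n).toNat : ℕ) : ℝ) = a n := by exact_mod_cast congrArg (Int.cast (R := ℝ)) (hcast n)
    rw [this]; exact hstep n
  · intro k hk
    simp only [hcast] at hk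
    refine not_altLt_shift_of_orbit (by linarith) h0 (fun n => (hs n).2) hfl hstep k ?_
    rcases altLt_or_eq_or_altLt uSeq a with h | h | h
    · exact absurd h hnot
    · rwa [h] at hk
    · exact h.trans hk
end

section
/- Let a_1 a_2 ⋯ be a sequence of non-negative integers and β > 1. Then the following are equivalent: (i) −Σ_{j≥1} (a_j+1)/(−β)^j = 1 and −Σ_{j≥1} (a_{k+j}+1)/(−β)^j ∈ [0,1] for all k ≥ 1; (ii) P_n(β) ∈ [0,1] for all n ≥ 1. Moreover, if (i) holds then P_n(β) = −Σ_{j≥1} (a_{n+j}+1)/(−β)^j for all n ≥ 1. -/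
open Filter Set

theorem Pn_eq_pow_mul_partial_sum (a : ℕ → ℤ) (n : ℕ) {x : ℝ} (hx : x ≠ 0) :
    Pn a n x = (-x) ^ n * (1 + ∑ j ∈ Finset.range n, ((a j : ℝ) + 1) / (-x) ^ (j + 1)) := by
  have hx' : -x ≠ 0 := neg_ne_zero.mpr hx
  rw [Pn, mul_add, mul_one, Finset.mul_sum]
  congr 1
  refine Finset.sum_congr rfl fun j hj => ?_
  have hjn : n = (n - 1 - j) + (j + 1) := by
    have := Finset.mem_range.mp hj
    omega
  have hpow : (-x) ^ n = (-x) ^ (n - 1 - j) * (-x) ^ (j + 1) := by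
    rw [← pow_add, ← hjn]
  rw [hpow]
  field_simp

theorem Pn_zero (a : ℕ → ℤ) (x : ℝ) : Pn a 0 x = 1 := by
  simp [Pn]

theorem Pn_succ (a : ℕ → ℤ) (n : ℕ) {x : ℝ} (hx : x ≠ 0) :
    Pn a (n + 1) x = -x * Pn a n x + ((a n : ℝ) + 1) := by
  have hpow : (-x) ^ (n + 1) ≠ 0 := pow_ne_zero _ (neg_ne_zero.mpr hx)
  rw [Pn_eq_pow_mul_partial_sum a _ hx, Pn_eq_pow_mul_partial_sum a _ hx,
    Finset.sum_range_succ, ← add_assoc, mul_add, mul_div_cancel₀ _ hpow]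
  ring

theorem Pn_eq_neg_tsum (a : ℕ → ℤ) {x : ℝ} (hx : x ≠ 0)
    (h : HasSum (fun j : ℕ => ((a j : ℝ) + 1) / (-x) ^ (j + 1)) (-1)) (n : ℕ) :
    Pn a n x = -(∑' j : ℕ, ((a (n + j) : ℝ) + 1) / (-x) ^ (j + 1)) := by
  have hx' : -x ≠ 0 := neg_ne_zero.mpr hx
  have hsplit := h.summable.sum_add_tsum_nat_add n
  rw [h.tsum_eq] at hsplit
  have htail : (-x) ^ n * ∑' j : ℕ, ((a (j + n) : ℝ) + 1) / (-x) ^ (j + n + 1) =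
      ∑' j : ℕ, ((a (n + j) : ℝ) + 1) / (-x) ^ (j + 1) := by
    rw [← tsum_mul_left]
    refine tsum_congr fun j => ?_
    rw [add_comm n j, add_right_comm j n 1, pow_add _ (j + 1) n]
    field_simp
  rw [Pn_eq_pow_mul_partial_sum a n hx, ← htail, ← mul_neg]
  congr 1
  linarith

theorem hasSum_neg_one_of_Pn_mem_Icc (a : ℕ → ℤ) {x : ℝ} (hx : 1 < x)
    (h : ∀ n, Pn a n x ∈ Set.Icc (0 : ℝ) 1) :
    HasSum (fun j : ℕ => ((a j : ℝ) + 1) / (-x) ^ (j + 1)) (-1) := by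
  have hx0 : 0 < x := by linarith
  have hr : Summable fun j : ℕ => (1 + x) * x⁻¹ ^ (j + 1) :=
    ((summable_nat_add_iff 1).mpr
      (summable_geometric_of_lt_one (inv_nonneg.mpr hx0.le) (inv_lt_one_of_one_lt₀ hx))).mul_left _
  have hsum : Summable fun j : ℕ => ((a j : ℝ) + 1) / (-x) ^ (j + 1) := by
    refine Summable.of_norm_bounded hr fun j => ?_
    have hrec := Pn_succ a j hx0.ne'
    obtain ⟨h0, h1⟩ := h j
    obtain ⟨h2, h3⟩ := h (j + 1)
    have hdigit : |(a j : ℝ) + 1| ≤ 1 + x := by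
      rw [abs_le]
      constructor <;> nlinarith
    rw [norm_div, norm_pow, norm_neg, Real.norm_eq_abs, Real.norm_eq_abs, abs_of_pos hx0,
      inv_pow, ← div_eq_mul_inv]
    gcongr
  refine (hsum.hasSum_iff_tendsto_nat).mpr ?_
  rw [tendsto_iff_norm_sub_tendsto_zero]
  refine squeeze_zero (fun _ => norm_nonneg _) (fun n => ?_)
    (tendsto_pow_atTop_nhds_zero_of_lt_one (inv_nonneg.mpr hx0.le) (inv_lt_one_of_one_lt₀ hx))
  have hP := Pn_eq_pow_mul_partial_sum a n hx0.ne'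
  obtain ⟨h0, h1⟩ := h n
  have hnorm : |Pn a n x| ≤ 1 := abs_le.mpr ⟨by linarith, h1⟩
  rw [hP, abs_mul, abs_pow, abs_neg, abs_of_pos hx0] at hnorm
  rw [sub_neg_eq_add, add_comm, Real.norm_eq_abs, inv_pow, ← one_div, le_div_iff₀' (by positivity)]
  exact hnorm

/-- the negative-base sum conditions are equivalent to
P_n(β) ∈ [0,1] for all n ≥ 1; moreover in that case
P_n(β) = −Σ_{j≥1}(a_{n+j}+1)/(−β)^j. -/
theorem stmt_12 (a : ℕ → ℤ) (hpos : ∀ n, 0 ≤ a n) (β : ℝ) (hβ : 1 < β) :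
    ((-(∑' j : ℕ, ((a j : ℝ) + 1) / (-β) ^ (j + 1)) = 1 ∧
        ∀ k : ℕ, 1 ≤ k →
          -(∑' j : ℕ, ((a (k + j) : ℝ) + 1) / (-β) ^ (j + 1)) ∈ Set.Icc (0 : ℝ) 1) ↔
      ∀ n : ℕ, 1 ≤ n → Pn a n β ∈ Set.Icc (0 : ℝ) 1) ∧
    ((-(∑' j : ℕ, ((a j : ℝ) + 1) / (-β) ^ (j + 1)) = 1 ∧
        ∀ k : ℕ, 1 ≤ k →
          -(∑' j : ℕ, ((a (k + j) : ℝ) + 1) / (-β) ^ (j + 1)) ∈ Set.Icc (0 : ℝ) 1) →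
      ∀ n : ℕ, 1 ≤ n →
        Pn a n β = -(∑' j : ℕ, ((a (n + j) : ℝ) + 1) / (-β) ^ (j + 1))) := by
  have hβ0 : β ≠ 0 := by linarith
  have hasSum_of_tsum : -(∑' j : ℕ, ((a j : ℝ) + 1) / (-β) ^ (j + 1)) = 1 →
      HasSum (fun j : ℕ => ((a j : ℝ) + 1) / (-β) ^ (j + 1)) (-1) := by
    intro h
    have htsum : ∑' j : ℕ, ((a j : ℝ) + 1) / (-β) ^ (j + 1) = -1 := by linarith
    have hsum : Summable fun j : ℕ => ((a j : ℝ) + 1) / (-β) ^ (j + 1) := by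
      by_contra hns
      rw [tsum_eq_zero_of_not_summable hns] at h
      norm_num at h
    exact htsum ▸ hsum.hasSum
  refine ⟨⟨fun ⟨h1, h2⟩ n hn => ?_, fun h => ?_⟩, fun ⟨h1, _⟩ n _ =>
    Pn_eq_neg_tsum a hβ0 (hasSum_of_tsum h1) n⟩
  · rw [Pn_eq_neg_tsum a hβ0 (hasSum_of_tsum h1) n]
    exact h2 n hn
  · have hS := hasSum_neg_one_of_Pn_mem_Icc a hβ fun n => by
      rcases Nat.eq_zero_or_pos n with rfl | hn
      · simp [Pn_zero]
      · exact h n hn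
    refine ⟨by rw [hS.tsum_eq, neg_neg], fun k hk => ?_⟩
    rw [← Pn_eq_neg_tsum a hβ0 hS k]
    exact h k hk
end
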